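/- Let p > 2 with p not an even integer. Then there exists q(p) < p such that for every q with q(p) < q ≤ p, every 0-symmetric open set E ⊂ 𝕋 with |E| > 0, and every ε > 0, there exists a positive definite trigonometric polynomial f such that ∫_{𝕋∖E} |f|^p ≤ ε · (∫_𝕋 |f|^q)^{p/q}. -/

import Mathlib

open MeasureTheory Finset

local notation "𝕋" => AddCircle (1 : ℝ)

theorem integrable_of_continuous_circle {E : Type*} [NormedAddCommGroup E]
    {f : 𝕋 → E} (hf : Continuous f) : Integrable f :=
  hf.integrable_of_hasCompactSupport (HasCompactSupport.of_compactSpace f)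

theorem continuous_integral_circle {X : Type*} [TopologicalSpace X] [FirstCountableTopology X]
    [LocallyCompactSpace X] {f : X → 𝕋 → ℝ} (hf : Continuous (Function.uncurry f)) :
    Continuous fun x ↦ ∫ y, f x y := by
  simpa using continuous_parametric_integral_of_continuous (μ := (volume : Measure 𝕋)) hf
    isCompact_univ

theorem volume_real_circle : (volume : Measure 𝕋).real Set.univ = 1 := by
  simp [Measure.real, AddCircle.measure_univ]

theorem exists_nonneg_lt_one_coe_eq (y : 𝕋) : ∃ t : ℝ, 0 ≤ t ∧ t < 1 ∧ (t : 𝕋) = y := by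
  have := (AddCircle.equivIco (1 : ℝ) 0 y).2
  refine ⟨(AddCircle.equivIco (1 : ℝ) 0 y : ℝ), this.1, by simpa using this.2, ?_⟩
  exact AddCircle.coe_equivIco

theorem tendsto_integral_dilate {Ψ : 𝕋 → 𝕋 → ℝ} (hΨ : Continuous (Function.uncurry Ψ)) :
    Filter.Tendsto (fun L : ℕ ↦ ∫ x, Ψ x (L • x)) Filter.atTop (nhds (∫ x, ∫ y, Ψ x y)) := by
  rw [Metric.tendsto_atTop]
  intro ε hε
  obtain ⟨δ, hδ, hδε⟩ := Metric.uniformContinuous_iff.1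
    (CompactSpace.uniformContinuous_of_continuous hΨ) (ε / 2) (half_pos hε)
  obtain ⟨N, hN⟩ := exists_nat_gt (1 / δ)
  refine ⟨N, fun L hL ↦ ?_⟩
  have hL' : 1 / δ < (L : ℝ) := hN.trans_le (by exact_mod_cast hL)
  have hLpos : (0 : ℝ) < L := (by positivity : (0 : ℝ) < 1 / δ).trans hL'
  have hcont (y : 𝕋) : Continuous fun x ↦ Ψ x (L • x + y) :=
    hΨ.comp (continuous_id.prodMk ((continuous_id.nsmul L).add continuous_const))
  have hcont0 : Continuous fun x ↦ Ψ x (L • x) := by simpa using hcont 0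
  have key (y : 𝕋) : ‖(∫ x, Ψ x (L • x)) - ∫ x, Ψ x (L • x + y)‖ ≤ ε / 2 := by
    obtain ⟨t, ht0, ht1, rfl⟩ := exists_nonneg_lt_one_coe_eq y
    have hshift : (L : ℕ) • ((t / L : ℝ) : 𝕋) = (t : 𝕋) := by
      rw [← AddCircle.coe_nsmul, nsmul_eq_mul, mul_div_cancel₀ _ hLpos.ne']
    rw [← integral_add_right_eq_self (fun x ↦ Ψ x (L • x)) ((t / L : ℝ) : 𝕋)]
    simp only [nsmul_add, hshift]
    have hc1 : Continuous fun x : 𝕋 ↦ Ψ (x + ((t / L : ℝ) : 𝕋)) (L • x + (t : 𝕋)) :=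
      hΨ.comp ((continuous_id.add continuous_const).prodMk
        ((continuous_id.nsmul L).add continuous_const))
    rw [← integral_sub (integrable_of_continuous_circle hc1)
      (integrable_of_continuous_circle (hcont _))]
    refine (norm_integral_le_of_norm_le_const (C := ε / 2) (.of_forall fun x ↦ ?_)).trans ?_
    · rw [← dist_eq_norm]
      refine (hδε (a := (x + ((t / L : ℝ) : 𝕋), L • x + (t : 𝕋))) (b := (x, L • x + (t : 𝕋))) ?_).le
      rw [Prod.dist_eq, dist_self, max_eq_left dist_nonneg, dist_eq_norm, add_sub_cancel_left]
      refine (QuotientAddGroup.norm_mk_le_norm (S := AddSubgroup.zmultiples (1 : ℝ))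
        (m := (t / L : ℝ))).trans_lt ?_
      rw [Real.norm_eq_abs, abs_of_nonneg (by positivity), div_lt_iff₀ hLpos]
      rw [div_lt_iff₀ hδ] at hL'
      linarith [mul_comm δ (L : ℝ)]
    · rw [volume_real_circle, mul_one]
  have hc2 : Continuous fun z : 𝕋 × 𝕋 ↦ Ψ z.1 (L • z.1 + z.2) :=
    hΨ.comp (continuous_fst.prodMk ((continuous_fst.nsmul L).add continuous_snd))
  have hswap : ∫ x, ∫ y, Ψ x y = ∫ y, ∫ x, Ψ x (L • x + y) := by
    rw [← integral_integral_swap (f := fun x y ↦ Ψ x (L • x + y))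
      (hc2.integrable_of_hasCompactSupport (HasCompactSupport.of_compactSpace _))]
    congr 1 with x
    exact (integral_add_left_eq_self (fun y ↦ Ψ x y) (L • x)).symm
  have hc3 : Continuous fun y ↦ ∫ x, Ψ x (L • x + y) :=
    continuous_integral_circle (f := fun y x ↦ Ψ x (L • x + y)) (hc2.comp continuous_swap)
  rw [hswap, dist_eq_norm]
  have h1 : (∫ x, Ψ x (L • x)) = ∫ _ : 𝕋, ∫ x, Ψ x (L • x) := by
    rw [integral_const, volume_real_circle, one_smul]
  rw [h1, ← integral_sub (integrable_const _) (integrable_of_continuous_circle hc3)]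
  refine (norm_integral_le_of_norm_le_const (C := ε / 2) (.of_forall key)).trans_lt ?_
  rw [volume_real_circle]; linarith

/-- The semiring of positive definite trigonometric polynomials on the unit circle. -/
noncomputable def posDefPoly : Subalgebra NNReal C(𝕋, ℂ) :=
  Algebra.adjoin NNReal (Set.range fourier)

theorem fourier_mem_posDefPoly (k : ℤ) : fourier k ∈ posDefPoly :=
  Algebra.subset_adjoin ⟨k, rfl⟩

theorem ofReal_smul_mem_posDefPoly {f : C(𝕋, ℂ)} {r : ℝ} (hr : 0 ≤ r) (hf : f ∈ posDefPoly) :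
    (r : ℂ) • f ∈ posDefPoly := by
  convert Subalgebra.smul_mem _ hf r.toNNReal using 1
  ext x
  simp only [ContinuousMap.smul_apply, NNReal.smul_def, Real.coe_toNNReal r hr, smul_eq_mul,
    Complex.real_smul]

theorem toSubmodule_posDefPoly :
    Subalgebra.toSubmodule posDefPoly = Submodule.span NNReal (Set.range fourier) := by
  refine Algebra.adjoin_eq_span_of_subset NNReal fun f hf ↦ Submodule.subset_span ?_
  induction hf using Submonoid.closure_induction with
  | mem f hf => exact hf
  | one => exact ⟨0, by ext; simp⟩
  | mul f g _ _ hf hg =>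
    obtain ⟨k, rfl⟩ := hf
    obtain ⟨l, rfl⟩ := hg
    exact ⟨k + l, by ext x; simp ⟩

theorem exists_coeff_of_mem_posDefPoly {f : C(𝕋, ℂ)} (hf : f ∈ posDefPoly) :
    ∃ (H : Finset ℤ) (c : ℤ → ℝ), (∀ k ∈ H, 0 < c k) ∧
      ∀ x, f x = ∑ k ∈ H, (c k : ℂ) * fourier k x := by
  rw [← Subalgebra.mem_toSubmodule, toSubmodule_posDefPoly,
    Finsupp.mem_span_range_iff_exists_finsupp] at hf
  obtain ⟨c, rfl⟩ := hf
  refine ⟨c.support, fun k ↦ (c k : ℝ), fun k hk ↦ ?_, fun x ↦ ?_⟩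
  · exact NNReal.coe_pos.2 (pos_iff_ne_zero.2 (Finsupp.mem_support_iff.1 hk))
  · rw [Finsupp.sum, ContinuousMap.coe_sum, Finset.sum_apply]
    rfl

/-- The dilation `x ↦ f (L x)` of a continuous function on the circle. -/
noncomputable def dilate (L : ℕ) (f : C(𝕋, ℂ)) : C(𝕋, ℂ) :=
  f.comp ⟨fun x ↦ L • x, continuous_id.nsmul L⟩

theorem dilate_apply (L : ℕ) (f : C(𝕋, ℂ)) (x : 𝕋) : dilate L f x = f (L • x) := rfl

theorem dilate_mem_posDefPoly {f : C(𝕋, ℂ)} (hf : f ∈ posDefPoly) (L : ℕ) :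
    dilate L f ∈ posDefPoly := by
  induction hf using Algebra.adjoin_induction with
  | mem f hf =>
    obtain ⟨k, rfl⟩ := hf
    convert fourier_mem_posDefPoly (L * k) using 1
    ext x
    simp only [dilate_apply, fourier_apply, mul_smul, natCast_zsmul]
    rw [smul_comm]
  | algebraMap r => exact Subalgebra.algebraMap_mem _ r
  | add f g _ _ hf hg => exact Subalgebra.add_mem _ hf hg
  | mul f g _ _ hf hg => exact Subalgebra.mul_mem _ hf hg

/-- The even translate average `x ↦ (f (x - a) + f (x + a)) / 2`. -/
noncomputable def translateAvg (a : 𝕋) (f : C(𝕋, ℂ)) : C(𝕋, ℂ) :=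
  ⟨fun x ↦ (f (x - a) + f (x + a)) / 2, by fun_prop⟩

theorem translateAvg_apply (a : 𝕋) (f : C(𝕋, ℂ)) (x : 𝕋) :
    translateAvg a f x = (f (x - a) + f (x + a)) / 2 := rfl

theorem translateAvg_fourier (a : 𝕋) (k : ℤ) (x : 𝕋) :
    translateAvg a (fourier k) x = ((fourier k a).re : ℂ) * fourier k x := by
  rw [translateAvg_apply, sub_eq_add_neg, fourier_apply, fourier_apply, smul_add, smul_add,
    AddCircle.toCircle_add, AddCircle.toCircle_add, Circle.coe_mul, Circle.coe_mul,
    ← fourier_apply, ← fourier_apply, ← fourier_apply, Complex.re_eq_add_conj, ← fourier_neg]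
  have : (fourier k (-a) : ℂ) = fourier (-k) a := by
    rw [fourier_apply, fourier_apply, smul_neg, neg_smul]
  rw [this]; ring

theorem add_sub_translateAvg_mem_posDefPoly {f : C(𝕋, ℂ)} (hf : f ∈ posDefPoly) (a : 𝕋) :
    f + translateAvg a f ∈ posDefPoly ∧ f - translateAvg a f ∈ posDefPoly := by
  rw [← Subalgebra.mem_toSubmodule, toSubmodule_posDefPoly] at hf
  induction hf using Submodule.span_induction with
  | mem f hf =>
    obtain ⟨k, rfl⟩ := hf
    have hre : |(fourier k a : ℂ).re| ≤ 1 := by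
      refine (Complex.abs_re_le_norm _).trans ?_
      rw [fourier_apply, Circle.norm_coe]
    obtain ⟨h1, h2⟩ := abs_le.1 hre
    constructor
    · convert ofReal_smul_mem_posDefPoly (r := 1 + (fourier k a : ℂ).re) (by linarith)
        (fourier_mem_posDefPoly k) using 1
      ext x
      simp only [ContinuousMap.add_apply, translateAvg_fourier, ContinuousMap.smul_apply,
        smul_eq_mul]
      push_cast; ring
    · convert ofReal_smul_mem_posDefPoly (r := 1 - (fourier k a : ℂ).re) (by linarith)
        (fourier_mem_posDefPoly k) using 1
      ext x
      simp only [ContinuousMap.sub_apply, translateAvg_fourier, ContinuousMap.smul_apply,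
        smul_eq_mul]
      push_cast; ring
  | zero =>
    have : translateAvg a 0 = 0 := by ext x; simp [translateAvg_apply]
    simp [this]
  | add f g _ _ hf hg =>
    constructor
    · convert Subalgebra.add_mem _ hf.1 hg.1 using 1
      ext x; simp only [ContinuousMap.add_apply, translateAvg_apply]; ring
    · convert Subalgebra.add_mem _ hf.2 hg.2 using 1
      ext x; simp only [ContinuousMap.add_apply, ContinuousMap.sub_apply, translateAvg_apply]; ring
  | smul r f _ hf =>
    constructor
    · convert Subalgebra.smul_mem _ hf.1 r using 1
      ext x
      simp only [ContinuousMap.add_apply, translateAvg_apply, ContinuousMap.smul_apply,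
        NNReal.smul_def, Complex.real_smul]; ring
    · convert Subalgebra.smul_mem _ hf.2 r using 1
      ext x
      simp only [ContinuousMap.sub_apply, translateAvg_apply, ContinuousMap.smul_apply,
        NNReal.smul_def, Complex.real_smul]; ring

theorem norm_rpow_add_tangent_le {p : ℝ} (hp : 2 < p) (v w : ℂ) :
    ‖v‖ ^ p + p * (‖v‖ ^ (p - 2) * (starRingEnd ℂ v * w).re) ≤ ‖v + w‖ ^ p := by
  rcases eq_or_ne v 0 with rfl | hv
  · rw [norm_zero, Real.zero_rpow (by linarith)]
    simp only [map_zero, zero_mul, Complex.zero_re, mul_zero, add_zero]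
    positivity
  have hv' : 0 < ‖v‖ := norm_pos_iff.2 hv
  have hsq : ‖v + w‖ ^ 2 = ‖v‖ ^ 2 + 2 * (starRingEnd ℂ v * w).re + ‖w‖ ^ 2 := by
    rw [Complex.sq_norm, Complex.sq_norm, Complex.sq_norm, Complex.normSq_add]
    have : (v * starRingEnd ℂ w).re = (starRingEnd ℂ v * w).re := by
      simp [Complex.mul_re]
    rw [this]; ring
  set s : ℝ := ‖v + w‖ ^ 2 / ‖v‖ ^ 2 - 1 with hs
  have hs1 : -1 ≤ s := by
    have : 0 ≤ ‖v + w‖ ^ 2 / ‖v‖ ^ 2 := by positivity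
    linarith
  have hB := one_add_mul_self_le_rpow_one_add hs1 (p := p / 2) (by linarith)
  have h1s : 1 + s = (‖v + w‖ / ‖v‖) ^ (2 : ℝ) := by
    rw [Real.rpow_two, div_pow, hs]; ring
  rw [h1s, ← Real.rpow_mul (by positivity), mul_div_cancel₀ _ two_ne_zero,
    Real.div_rpow (norm_nonneg _) (norm_nonneg _), le_div_iff₀ (by positivity)] at hB
  refine le_trans ?_ hB
  have hpow : ‖v‖ ^ p = ‖v‖ ^ (p - 2) * ‖v‖ ^ 2 := by
    rw [← Real.rpow_two, ← Real.rpow_add hv']; ring_nf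
  have hss : s * ‖v‖ ^ 2 = 2 * (starRingEnd ℂ v * w).re + ‖w‖ ^ 2 := by
    rw [hs, sub_mul, div_mul_cancel₀ _ (by positivity), hsq]; ring
  have : (1 + p / 2 * s) * ‖v‖ ^ p = ‖v‖ ^ p + p * (‖v‖ ^ (p - 2) * (starRingEnd ℂ v * w).re)
      + p / 2 * (‖v‖ ^ (p - 2) * ‖w‖ ^ 2) := by
    have h3 : (1 + p / 2 * s) * ‖v‖ ^ p = ‖v‖ ^ p + p / 2 * ‖v‖ ^ (p - 2) * (s * ‖v‖ ^ 2) := by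
      rw [hpow]; ring
    rw [h3, hss]; ring
  rw [this]
  have : 0 ≤ p / 2 * (‖v‖ ^ (p - 2) * ‖w‖ ^ 2) := by positivity
  linarith

theorem exists_ring_choose_neg {a : ℝ} (ha : 0 ≤ a) (hn : ∀ m : ℕ, a ≠ m) :
    ∃ n : ℕ, Ring.choose a n < 0 := by
  refine ⟨⌊a⌋₊ + 2, ?_⟩
  have h1 : (⌊a⌋₊ : ℝ) < a := lt_of_le_of_ne (Nat.floor_le ha) (hn _).symm
  have h2 : a < ⌊a⌋₊ + 1 := Nat.lt_floor_add_one a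
  rw [Ring.choose_eq_smul, smul_eq_mul]
  refine mul_neg_of_pos_of_neg (by positivity) ?_
  rw [Polynomial.descPochhammer_smeval_eq_ascPochhammer, Polynomial.ascPochhammer_smeval_cast,
    Polynomial.ascPochhammer_smeval_eq_eval, ← descPochhammer_eval_eq_ascPochhammer]
  rw [descPochhammer_succ_eval]
  refine mul_neg_of_pos_of_neg (descPochhammer_pos ?_) ?_ <;> push_cast <;> linarith

theorem integral_comp_fourier_one {h : ℂ → ℂ}
    (hh : ∀ z ∈ Metric.closedBall (0 : ℂ) 1, DifferentiableAt ℂ h z) :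
    ∫ x : 𝕋, h (fourier 1 x) = h 0 := by
  have h1 : DiffContOnCl ℂ h (Metric.ball 0 |1|) := by
    apply DifferentiableOn.diffContOnCl
    intro z hz
    rw [abs_one, closure_ball _ one_ne_zero] at hz
    exact (hh z hz).differentiableWithinAt
  rw [← h1.circleAverage, Real.circleAverage, ← AddCircle.intervalIntegral_preimage 1 0]
  have := intervalIntegral.smul_integral_comp_mul_left (a := 0) (b := 1)
    (fun θ ↦ h (circleMap 0 1 θ)) (2 * Real.pi)
  rw [mul_zero, mul_one] at this
  rw [← this, smul_smul, inv_mul_cancel₀ (by positivity), one_smul, zero_add]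
  congr 1 with t
  rw [fourier_coe_apply, circleMap]
  congr 1
  push_cast
  rw [zero_add, one_mul]
  congr 1
  simp
  ring

theorem exists_binomial_remainder_bound (a : ℂ) (n : ℕ) :
    ∃ C δ : ℝ, 0 < C ∧ 0 < δ ∧ ∀ z : ℂ, ‖z‖ < δ →
      ‖(1 + z) ^ a - ∑ j ∈ range (n + 1), Ring.choose a j * z ^ j‖ ≤ C * ‖z‖ ^ (n + 1) := by
  obtain ⟨C, hC, h⟩ := (Complex.one_add_cpow_hasFPowerSeriesAt_zero
    (a := a)).isBigO_sub_partialSum_pow (n + 1) |>.exists_pos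
  obtain ⟨δ, hδ, h⟩ := Metric.eventually_nhds_iff.1 h.bound
  refine ⟨C, δ, hC, hδ, fun z hz ↦ ?_⟩
  have := h (y := z) (by simpa using hz)
  simpa [FormalMultilinearSeries.partialSum, binomialSeries,
    FormalMultilinearSeries.coeff_ofScalars, mul_comm] using this

theorem norm_fourier_apply (k : ℤ) (x : 𝕋) : ‖(fourier k x : ℂ)‖ = 1 := by
  rw [fourier_apply, Circle.norm_coe]

theorem fourier_natCast_eq_pow (n : ℕ) (x : 𝕋) : (fourier n x : ℂ) = fourier 1 x ^ n := by
  simp [fourier_apply, AddCircle.toCircle_nsmul]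

theorem integral_pow_mul_cpow {ρ : ℝ} (hρ0 : 0 < ρ) (hρ1 : ρ < 1) (b : ℂ) (m : ℕ) :
    ∫ x : 𝕋, (fourier 1 x : ℂ) ^ m * (1 + ρ * fourier 1 x) ^ b = if m = 0 then 1 else 0 := by
  rw [integral_comp_fourier_one (h := fun z ↦ z ^ m * (1 + ρ * z) ^ b)]
  · rcases eq_or_ne m 0 with rfl | hm <;> simp_all
  · intro z hz
    have hz' : ‖(ρ : ℂ) * z‖ < 1 := by
      rw [norm_mul, Complex.norm_real, Real.norm_of_nonneg hρ0.le]
      have : ‖z‖ ≤ 1 := by simpa using hz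
      nlinarith
    refine (differentiableAt_id.pow m).mul (DifferentiableAt.cpow ?_ ?_ ?_)
    · fun_prop
    · fun_prop
    · exact Complex.mem_slitPlane_of_norm_lt_one hz'

theorem exists_integral_neg {p : ℝ} (hp : 2 < p) (hpe : ∀ m : ℕ, p ≠ 2 * m) :
    ∃ (ρ : ℝ) (n : ℕ), 0 < ρ ∧ ∫ x : 𝕋, ‖1 + ρ * (fourier 1 x : ℂ)‖ ^ (p - 2) *
      (starRingEnd ℂ (1 + ρ * (fourier 1 x : ℂ)) * fourier n x).re < 0 := by
  obtain ⟨n, hn⟩ := exists_ring_choose_neg (a := p / 2) (by linarith)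
    (fun m hm ↦ hpe m (by linarith))
  obtain ⟨C, δ, hC, hδ, hbound⟩ := exists_binomial_remainder_bound (p / 2 : ℝ) n
  set a : ℝ := p / 2 with ha
  set M : ℝ := 2 ^ (a - 1) with hM
  have hMpos : 0 < M := by positivity
  obtain ⟨ρ, hρ0, hρ⟩ : ∃ ρ : ℝ, 0 < ρ ∧ ρ < min (min δ 1) (-Ring.choose a n / (C * M)) :=
    exists_between (lt_min (lt_min hδ one_pos) (div_pos (neg_pos.2 hn) (by positivity)))
  obtain ⟨h1, hρ2⟩ := lt_min_iff.1 hρ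
  obtain ⟨hρδ, hρ1⟩ := lt_min_iff.1 h1
  refine ⟨ρ, n, hρ0, ?_⟩
  set z : 𝕋 → ℂ := fun x ↦ fourier 1 x with hz
  have hz1 (x : 𝕋) : ‖z x‖ = 1 := norm_fourier_apply 1 x
  have hzc : Continuous z := (fourier 1).continuous
  have hρz (x : 𝕋) : ‖(ρ : ℂ) * z x‖ = ρ := by
    rw [norm_mul, hz1, mul_one, Complex.norm_real, Real.norm_of_nonneg hρ0.le]
  have hslit (x : 𝕋) : 1 + ρ * z x ∈ Complex.slitPlane :=
    Complex.mem_slitPlane_of_norm_lt_one (by rw [hρz]; exact hρ1)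
  have hne (x : 𝕋) : 1 + ρ * z x ≠ 0 := Complex.slitPlane_ne_zero (hslit x)
  set u : 𝕋 → ℂ := fun x ↦ (1 + ρ * z x) ^ ((a - 1 : ℝ) : ℂ) with hu
  set w : 𝕋 → ℂ := fun x ↦ (1 + ρ * z x) ^ ((a : ℝ) : ℂ) with hw
  have huc : Continuous u := Continuous.cpow (by fun_prop) continuous_const hslit
  have hwc : Continuous w := Continuous.cpow (by fun_prop) continuous_const hslit
  set S : 𝕋 → ℂ := fun x ↦ ∑ j ∈ range (n + 1), Ring.choose (a : ℂ) j * (ρ * z x) ^ j with hS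
  have hSc : Continuous S := by fun_prop
  have hpt (x : 𝕋) : ‖1 + ρ * z x‖ ^ (p - 2) * (starRingEnd ℂ (1 + ρ * z x) * fourier n x).re =
      (starRingEnd ℂ (w x) * u x * z x ^ n).re := by
    have hwu : w x = u x * (1 + ρ * z x) := by
      simp only [hw, hu]
      have := Complex.cpow_add ((a - 1 : ℝ) : ℂ) 1 (hne x)
      rw [Complex.cpow_one] at this
      rw [← this]; congr 1; push_cast; ring
    rw [hwu, map_mul, fourier_natCast_eq_pow]
    have : starRingEnd ℂ (u x) * starRingEnd ℂ (1 + ρ * z x) * u x * z x ^ n =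
        ((‖1 + ρ * z x‖ ^ (p - 2) : ℝ) : ℂ) * (starRingEnd ℂ (1 + ρ * z x) * z x ^ n) := by
      have h2 : starRingEnd ℂ (u x) * u x = ((‖1 + ρ * z x‖ ^ (p - 2) : ℝ) : ℂ) := by
        rw [mul_comm, Complex.mul_conj, Complex.normSq_eq_norm_sq, hu, Complex.norm_cpow_real,
          ← Real.rpow_natCast, ← Real.rpow_mul (norm_nonneg _)]
        congr 2; rw [ha]; push_cast; ring
      rw [← h2]; ring
    rw [this, Complex.re_ofReal_mul]
  have hmain : ∫ x, starRingEnd ℂ (S x) * u x * z x ^ n = ((Ring.choose a n * ρ ^ n : ℝ) : ℂ) := by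
    have hexp (x : 𝕋) : starRingEnd ℂ (S x) * u x * z x ^ n = ∑ j ∈ range (n + 1),
        ((Ring.choose a j * ρ ^ j : ℝ) : ℂ) * (z x ^ (n - j) * u x) := by
      simp only [hS, map_sum, sum_mul]
      refine sum_congr rfl fun j hj ↦ ?_
      have hj' : j ≤ n := by simpa [Nat.lt_succ_iff] using hj
      have hzz : starRingEnd ℂ (z x) * z x = 1 := by
        rw [mul_comm, Complex.mul_conj, Complex.normSq_eq_norm_sq, hz1]; simp
      have h3 : starRingEnd ℂ (z x) ^ j * z x ^ n = z x ^ (n - j) := by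
        rw [← Nat.sub_add_cancel hj', pow_add, Nat.add_sub_cancel]
        rw [mul_comm (z x ^ (n - j)), ← mul_assoc, ← mul_pow, hzz, one_pow, one_mul]
      rw [← Complex.ofReal_choose, map_mul, map_pow, map_mul, Complex.conj_ofReal,
        Complex.conj_ofReal, ← h3]
      push_cast; ring
    simp_rw [hexp]
    rw [integral_finsetSum]
    · simp_rw [integral_const_mul, hu, hz]
      simp_rw [integral_pow_mul_cpow hρ0 hρ1]
      rw [Finset.sum_eq_single n]
      · simp
      · intro j hj hjn
        rw [if_neg, mul_zero]
        have : j < n + 1 := by simpa using hj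
        omega
      · simp
    · intro j _
      exact integrable_of_continuous_circle (by fun_prop)
  have hrem : ‖∫ x, starRingEnd ℂ (w x - S x) * u x * z x ^ n‖ ≤ C * ρ ^ (n + 1) * M := by
    refine (norm_integral_le_of_norm_le_const (C := C * ρ ^ (n + 1) * M)
      (.of_forall fun x ↦ ?_)).trans ?_
    · rw [norm_mul, norm_mul, norm_pow, hz1, one_pow, mul_one, RCLike.norm_conj]
      have h4 := hbound (ρ * z x) (by rw [hρz]; exact hρδ)
      rw [hρz] at h4
      refine mul_le_mul h4 ?_ (norm_nonneg _) (by positivity)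
      rw [hu, Complex.norm_cpow_real, hM]
      refine Real.rpow_le_rpow (norm_nonneg _) ((norm_add_le _ _).trans ?_) (by rw [ha]; linarith)
      rw [hρz, norm_one]; linarith
    · rw [volume_real_circle, mul_one]
  have hsum : ∫ x, starRingEnd ℂ (w x) * u x * z x ^ n =
      ((Ring.choose a n * ρ ^ n : ℝ) : ℂ) + ∫ x, starRingEnd ℂ (w x - S x) * u x * z x ^ n := by
    rw [← hmain, ← integral_add (integrable_of_continuous_circle (by fun_prop))
      (integrable_of_continuous_circle (by fun_prop))]
    congr 1 with x
    rw [map_sub]; ring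
  have hinteg : Integrable fun x ↦ starRingEnd ℂ (w x) * u x * z x ^ n :=
    integrable_of_continuous_circle (by fun_prop)
  calc ∫ x, ‖1 + ρ * z x‖ ^ (p - 2) * (starRingEnd ℂ (1 + ρ * z x) * fourier n x).re
      = ∫ x, (starRingEnd ℂ (w x) * u x * z x ^ n).re := by simp_rw [hpt]
    _ = (∫ x, starRingEnd ℂ (w x) * u x * z x ^ n).re := integral_re hinteg
    _ ≤ Ring.choose a n * ρ ^ n + C * ρ ^ (n + 1) * M := by
        rw [hsum, Complex.add_re, Complex.ofReal_re]
        gcongr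
        exact (Complex.re_le_norm _).trans hrem
    _ < 0 := by
        rw [lt_div_iff₀ (by positivity)] at hρ2
        have : 0 < ρ ^ n := by positivity
        have h5 : Ring.choose a n * ρ ^ n + C * ρ ^ (n + 1) * M =
          ρ ^ n * (Ring.choose a n + ρ * (C * M)) := by ring
        rw [h5]
        exact mul_neg_of_pos_of_neg this (by linarith)

theorem exists_majorant_failure {p : ℝ} (hp : 2 < p) (hpe : ∀ m : ℕ, p ≠ 2 * m) :
    ∃ G₀ ∈ posDefPoly, ∃ G₁ ∈ posDefPoly,
      ∫ x, ‖G₀ x + G₁ x‖ ^ p < ∫ x, ‖G₀ x - G₁ x‖ ^ p := by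
  obtain ⟨ρ, n, hρ, hneg⟩ := exists_integral_neg hp hpe
  have hcont : Continuous fun σ : ℝ ↦ ∫ x : 𝕋,
      ‖1 + ρ * (fourier 1 x : ℂ) + σ * fourier n x‖ ^ (p - 2) *
      (starRingEnd ℂ (1 + ρ * (fourier 1 x : ℂ) + σ * fourier n x) * fourier n x).re := by
    refine continuous_integral_circle (f := fun (σ : ℝ) (x : 𝕋) ↦
      ‖1 + ρ * (fourier 1 x : ℂ) + σ * fourier n x‖ ^ (p - 2) *
      (starRingEnd ℂ (1 + ρ * (fourier 1 x : ℂ) + σ * fourier n x) * fourier n x).re) ?_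
    have : Continuous fun q : ℝ × 𝕋 ↦ 1 + ρ * (fourier 1 q.2 : ℂ) + q.1 * fourier n q.2 := by
      fun_prop
    refine (this.norm.rpow_const fun _ ↦ .inr (by linarith)).mul (Complex.continuous_re.comp ?_)
    exact (Complex.continuous_conj.comp this).mul (by fun_prop)
  have hev := hcont.tendsto 0 |>.eventually_lt_const (u := 0) (by simpa using hneg)
  obtain ⟨δ, hδ, hδ'⟩ := Metric.eventually_nhds_iff.1 hev
  have hσ := hδ' (y := δ / 2) (by
    rw [Real.dist_eq, sub_zero, abs_of_pos (half_pos hδ)]; exact half_lt_self hδ)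
  set σ : ℝ := δ / 2
  have hσ0 : 0 < σ := half_pos hδ
  refine ⟨1 + (ρ : ℂ) • fourier 1, ?_, (σ : ℂ) • fourier n, ?_, ?_⟩
  · exact Subalgebra.add_mem _ (Subalgebra.one_mem _)
      (ofReal_smul_mem_posDefPoly hρ.le (fourier_mem_posDefPoly 1))
  · exact ofReal_smul_mem_posDefPoly hσ0.le (fourier_mem_posDefPoly n)
  simp only [ContinuousMap.add_apply, ContinuousMap.one_apply, ContinuousMap.smul_apply,
    smul_eq_mul]
  set v : 𝕋 → ℂ := fun x ↦ 1 + ρ * (fourier 1 x : ℂ) + σ * fourier n x with hv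
  have hvc : Continuous v := by fun_prop
  have hpos : 0 ≤ p := by linarith
  have hpow {f : 𝕋 → ℂ} (hf : Continuous f) {r : ℝ} (hr : 0 ≤ r) :
      Continuous fun x ↦ ‖f x‖ ^ r := hf.norm.rpow_const fun _ ↦ .inr hr
  have hDc : Continuous fun x ↦ ‖v x‖ ^ (p - 2) * (starRingEnd ℂ (v x) * fourier n x).re :=
    (hpow hvc (by linarith)).mul (Complex.continuous_re.comp
      ((Complex.continuous_conj.comp hvc).mul (by fun_prop)))
  calc ∫ x, ‖v x‖ ^ p
      < (∫ x, ‖v x‖ ^ p) - 2 * σ * p *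
          ∫ x, ‖v x‖ ^ (p - 2) * (starRingEnd ℂ (v x) * fourier n x).re := by
        have : 0 < 2 * σ * p := by positivity
        nlinarith
    _ = ∫ x, (‖v x‖ ^ p + p * (‖v x‖ ^ (p - 2) *
          (starRingEnd ℂ (v x) * ((-(2 * σ) : ℝ) * fourier n x)).re)) := by
        rw [← integral_const_mul, ← integral_sub (integrable_of_continuous_circle (hpow hvc hpos))
          (integrable_of_continuous_circle (by fun_prop))]
        congr 1 with x
        rw [mul_left_comm (starRingEnd ℂ (v x)), Complex.re_ofReal_mul]
        ring
    _ ≤ ∫ x, ‖1 + ρ * (fourier 1 x : ℂ) - σ * fourier n x‖ ^ p := by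
        refine integral_mono (integrable_of_continuous_circle ?_)
          (integrable_of_continuous_circle (hpow (by fun_prop) hpos)) fun x ↦ ?_
        · refine (hpow hvc hpos).add (continuous_const.mul ((hpow hvc (by linarith)).mul
            (Complex.continuous_re.comp ((Complex.continuous_conj.comp hvc).mul (by fun_prop)))))
        · refine (norm_rpow_add_tangent_le hp (v x) _).trans_eq ?_
          congr 2
          simp only [hv]; push_cast; ring

theorem continuous_norm_rpow {X : Type*} [TopologicalSpace X] {f : X → ℂ} (hf : Continuous f)
    {r : ℝ} (hr : 0 ≤ r) : Continuous fun x ↦ ‖f x‖ ^ r :=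
  hf.norm.rpow_const fun _ ↦ .inr hr

theorem tendsto_integral_norm_mul_dilate_rpow {p : ℝ} (hp : 0 ≤ p) (f g : C(𝕋, ℂ)) :
    Filter.Tendsto (fun L : ℕ ↦ ∫ x, ‖f x * g (L • x)‖ ^ p) Filter.atTop
      (nhds ((∫ x, ‖f x‖ ^ p) * ∫ x, ‖g x‖ ^ p)) := by
  have := tendsto_integral_dilate (Ψ := fun x y ↦ ‖f x * g y‖ ^ p)
    (continuous_norm_rpow (f := fun q : 𝕋 × 𝕋 ↦ f q.1 * g q.2) (by fun_prop) hp)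
  convert this using 2
  simp_rw [norm_mul, Real.mul_rpow (norm_nonneg _) (norm_nonneg _), integral_const_mul,
    integral_mul_const]

theorem exists_large_majorant_failure {p : ℝ} (hp : 2 < p) (hpe : ∀ m : ℕ, p ≠ 2 * m) (M : ℝ) :
    ∃ G₀ ∈ posDefPoly, ∃ G₁ ∈ posDefPoly,
      M * ∫ x, ‖G₀ x + G₁ x‖ ^ p < ∫ x, ‖G₀ x - G₁ x‖ ^ p := by
  obtain ⟨G₀, hG₀, G₁, hG₁, hlt⟩ := exists_majorant_failure hp hpe
  have hp0 : 0 ≤ p := by linarith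
  set B := ∫ x, ‖G₀ x + G₁ x‖ ^ p with hB
  set A := ∫ x, ‖G₀ x - G₁ x‖ ^ p with hA
  have hB0 : 0 ≤ B := integral_nonneg fun x ↦ by positivity
  obtain ⟨b, hBb, hbA⟩ := exists_between hlt
  have hb : 0 < b := hB0.trans_lt hBb
  have hA0 : 0 < A := hb.trans hbA
  have key (N : ℕ) : ∃ H₀ ∈ posDefPoly, ∃ H₁ ∈ posDefPoly,
      ∫ x, ‖H₀ x + H₁ x‖ ^ p < 2 * b ^ N ∧ A ^ N / 2 < ∫ x, ‖H₀ x - H₁ x‖ ^ p := by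
    induction N with
    | zero =>
      refine ⟨1, Subalgebra.one_mem _, 0, Subalgebra.zero_mem _, ?_, ?_⟩ <;>
        norm_num [volume_real_circle]
    | succ N ih =>
      obtain ⟨H₀, hH₀, H₁, hH₁, h1, h2⟩ := ih
      have t1 := tendsto_integral_norm_mul_dilate_rpow hp0 (H₀ + H₁) (G₀ + G₁)
      have t2 := tendsto_integral_norm_mul_dilate_rpow hp0 (H₀ - H₁) (G₀ - G₁)
      have e1 : (∫ x, ‖(H₀ + H₁) x‖ ^ p) * ∫ x, ‖(G₀ + G₁) x‖ ^ p < 2 * b ^ (N + 1) := by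
        calc (∫ x, ‖(H₀ + H₁) x‖ ^ p) * ∫ x, ‖(G₀ + G₁) x‖ ^ p
            ≤ (∫ x, ‖(H₀ + H₁) x‖ ^ p) * b :=
              mul_le_mul_of_nonneg_left hBb.le (integral_nonneg fun x ↦ by positivity)
          _ < 2 * b ^ N * b := mul_lt_mul_of_pos_right h1 hb
          _ = 2 * b ^ (N + 1) := by ring
      have e2 : A ^ (N + 1) / 2 < (∫ x, ‖(H₀ - H₁) x‖ ^ p) * ∫ x, ‖(G₀ - G₁) x‖ ^ p := by
        calc A ^ (N + 1) / 2 = A ^ N / 2 * A := by ring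
          _ < _ := mul_lt_mul_of_pos_right h2 hA0
      obtain ⟨L, hL1, hL2⟩ := ((t1.eventually_lt_const e1).and (t2.eventually_const_lt e2)).exists
      refine ⟨H₀ * dilate L G₀ + H₁ * dilate L G₁, ?_, H₀ * dilate L G₁ + H₁ * dilate L G₀, ?_,
        lt_of_eq_of_lt ?_ hL1, lt_of_lt_of_eq hL2 ?_⟩
      · exact Subalgebra.add_mem _ (Subalgebra.mul_mem _ hH₀ (dilate_mem_posDefPoly hG₀ L))
          (Subalgebra.mul_mem _ hH₁ (dilate_mem_posDefPoly hG₁ L))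
      · exact Subalgebra.add_mem _ (Subalgebra.mul_mem _ hH₀ (dilate_mem_posDefPoly hG₁ L))
          (Subalgebra.mul_mem _ hH₁ (dilate_mem_posDefPoly hG₀ L))
      all_goals
        congr 1 with x
        simp only [ContinuousMap.add_apply, ContinuousMap.sub_apply, ContinuousMap.mul_apply,
          dilate_apply]
        ring_nf
  obtain ⟨N, hN⟩ := pow_unbounded_of_one_lt (4 * |M|) ((one_lt_div hb).2 hbA)
  obtain ⟨H₀, hH₀, H₁, hH₁, h1, h2⟩ := key N
  refine ⟨H₀, hH₀, H₁, hH₁, ?_⟩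
  rw [div_pow, lt_div_iff₀ (by positivity)] at hN
  calc M * ∫ x, ‖H₀ x + H₁ x‖ ^ p ≤ |M| * ∫ x, ‖H₀ x + H₁ x‖ ^ p :=
        mul_le_mul_of_nonneg_right (le_abs_self M) (integral_nonneg fun x ↦ by positivity)
    _ ≤ |M| * (2 * b ^ N) := mul_le_mul_of_nonneg_left h1.le (abs_nonneg M)
    _ ≤ A ^ N / 2 := by linarith
    _ < _ := h2

theorem exists_product_estimates {p q α β : ℝ} (hp : 0 ≤ p) (hq : 0 ≤ q) (hα : 0 < α)
    (hβ : 0 < β) {C₀ C₁ G₀ G₁ : C(𝕋, ℂ)} (hC₀ : C₀ ∈ posDefPoly) (hC₁ : C₁ ∈ posDefPoly)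
    (hG₀ : G₀ ∈ posDefPoly) (hG₁ : G₁ ∈ posDefPoly) {χ ψ : C(𝕋, ℝ)} (hχ0 : ∀ x, 0 ≤ χ x)
    (hψ0 : ∀ x, 0 ≤ ψ x) (hψ : 0 < ∫ x, ψ x)
    (hupper : ∀ x, χ x ≠ 0 → ∫ y, ‖C₀ x * G₀ y + C₁ x * G₁ y‖ ^ p ≤ β)
    (hlower : ∀ x, ψ x ≠ 0 → α ≤ ∫ y, ‖C₀ x * G₀ y + C₁ x * G₁ y‖ ^ q) (N : ℕ) :
    ∃ f ∈ posDefPoly, ∫ x, χ x * ‖f x‖ ^ p < ((∫ x, χ x) + 1) * β ^ N ∧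
      (∫ x, ψ x) / 2 * α ^ N < ∫ x, ψ x * ‖f x‖ ^ q := by
  have hpow (r : ℝ) (hr : 0 ≤ r) (f : C(𝕋, ℂ)) (ξ : C(𝕋, ℝ)) :
      Continuous fun x ↦ ξ x * ‖f x‖ ^ r :=
    ξ.continuous.mul (continuous_norm_rpow f.continuous hr)
  have hF (r : ℝ) (hr : 0 ≤ r) :
      Continuous fun z : 𝕋 × 𝕋 ↦ ‖C₀ z.1 * G₀ z.2 + C₁ z.1 * G₁ z.2‖ ^ r :=
    continuous_norm_rpow (by fun_prop) hr
  have hlim (r : ℝ) (hr : 0 ≤ r) (f : C(𝕋, ℂ)) (ξ : C(𝕋, ℝ)) :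
      Filter.Tendsto (fun L : ℕ ↦ ∫ x, ξ x * ‖f x‖ ^ r *
        ‖C₀ x * G₀ (L • x) + C₁ x * G₁ (L • x)‖ ^ r) Filter.atTop
      (nhds (∫ x, ξ x * ‖f x‖ ^ r * ∫ y, ‖C₀ x * G₀ y + C₁ x * G₁ y‖ ^ r)) := by
    have := tendsto_integral_dilate (Ψ := fun x y ↦ ξ x * ‖f x‖ ^ r *
      ‖C₀ x * G₀ y + C₁ x * G₁ y‖ ^ r) (((hpow r hr f ξ).comp continuous_fst).mul (hF r hr))
    simpa only [integral_const_mul] using this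
  have hinteg (r : ℝ) (hr : 0 ≤ r) (f : C(𝕋, ℂ)) (ξ : C(𝕋, ℝ)) :
      Integrable fun x ↦ ξ x * ‖f x‖ ^ r * ∫ y, ‖C₀ x * G₀ y + C₁ x * G₁ y‖ ^ r :=
    integrable_of_continuous_circle ((hpow r hr f ξ).mul (continuous_integral_circle (hF r hr)))
  induction N with
  | zero =>
    refine ⟨1, Subalgebra.one_mem _, ?_, ?_⟩
    · simp
    · simpa using hψ
  | succ N ih =>
    obtain ⟨f, hf, h1, h2⟩ := ih
    have e1 : ∫ x, χ x * ‖f x‖ ^ p * ∫ y, ‖C₀ x * G₀ y + C₁ x * G₁ y‖ ^ p <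
        ((∫ x, χ x) + 1) * β ^ (N + 1) := by
      calc ∫ x, χ x * ‖f x‖ ^ p * ∫ y, ‖C₀ x * G₀ y + C₁ x * G₁ y‖ ^ p
          ≤ ∫ x, χ x * ‖f x‖ ^ p * β := by
            refine integral_mono (hinteg p hp f χ)
              ((integrable_of_continuous_circle (hpow p hp f χ)).mul_const β) fun x ↦ ?_
            rcases eq_or_ne (χ x) 0 with h0 | h0
            · simp [h0]
            · exact mul_le_mul_of_nonneg_left (hupper x h0) (mul_nonneg (hχ0 x) (by positivity))
        _ = (∫ x, χ x * ‖f x‖ ^ p) * β := integral_mul_const _ _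
        _ < ((∫ x, χ x) + 1) * β ^ N * β := mul_lt_mul_of_pos_right h1 hβ
        _ = _ := by ring
    have e2 : (∫ x, ψ x) / 2 * α ^ (N + 1) <
        ∫ x, ψ x * ‖f x‖ ^ q * ∫ y, ‖C₀ x * G₀ y + C₁ x * G₁ y‖ ^ q := by
      calc (∫ x, ψ x) / 2 * α ^ (N + 1) = (∫ x, ψ x) / 2 * α ^ N * α := by ring
        _ < (∫ x, ψ x * ‖f x‖ ^ q) * α := mul_lt_mul_of_pos_right h2 hα
        _ = ∫ x, ψ x * ‖f x‖ ^ q * α := (integral_mul_const _ _).symm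
        _ ≤ _ := by
            refine integral_mono ((integrable_of_continuous_circle (hpow q hq f ψ)).mul_const α)
              (hinteg q hq f ψ) fun x ↦ ?_
            rcases eq_or_ne (ψ x) 0 with h0 | h0
            · simp [h0]
            · exact mul_le_mul_of_nonneg_left (hlower x h0) (mul_nonneg (hψ0 x) (by positivity))
    obtain ⟨L, hL1, hL2⟩ := (((hlim p hp f χ).eventually_lt_const e1).and
      ((hlim q hq f ψ).eventually_const_lt e2)).exists
    refine ⟨f * (C₀ * dilate L G₀ + C₁ * dilate L G₁), ?_, lt_of_eq_of_lt ?_ hL1,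
      lt_of_lt_of_eq hL2 ?_⟩
    · exact Subalgebra.mul_mem _ hf (Subalgebra.add_mem _
        (Subalgebra.mul_mem _ hC₀ (dilate_mem_posDefPoly hG₀ L))
        (Subalgebra.mul_mem _ hC₁ (dilate_mem_posDefPoly hG₁ L)))
    all_goals
      congr 1 with x
      simp only [ContinuousMap.add_apply, ContinuousMap.mul_apply, dilate_apply, norm_mul]
      rw [Real.mul_rpow (norm_nonneg _) (norm_nonneg _)]
      ring

/-- The polynomial `(1 + e₁) / 2`, whose modulus peaks only at the origin. -/
noncomputable def peak : C(𝕋, ℂ) := ((1 / 2 : ℝ) : ℂ) • (1 + fourier 1)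

theorem peak_mem_posDefPoly : peak ∈ posDefPoly :=
  ofReal_smul_mem_posDefPoly (by norm_num)
    (Subalgebra.add_mem _ (Subalgebra.one_mem _) (fourier_mem_posDefPoly 1))

theorem peak_apply (x : 𝕋) : peak x = (1 + fourier 1 x) / 2 := by
  simp only [peak, ContinuousMap.smul_apply, ContinuousMap.add_apply, ContinuousMap.one_apply,
    smul_eq_mul]
  push_cast; ring

theorem peak_zero : peak 0 = 1 := by
  rw [peak_apply, fourier_eval_zero]; norm_num

theorem norm_peak_le_one (x : 𝕋) : ‖peak x‖ ≤ 1 := by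
  rw [peak_apply, norm_div, Complex.norm_ofNat, div_le_one two_pos]
  refine (norm_add_le _ _).trans ?_
  rw [norm_one, norm_fourier_apply]; norm_num

theorem norm_peak_lt_one {x : 𝕋} (hx : x ≠ 0) : ‖peak x‖ < 1 := by
  set w : ℂ := fourier 1 x with hw
  have hw1 : ‖w‖ = 1 := norm_fourier_apply 1 x
  have hne : w ≠ 1 := by
    intro h
    apply hx
    apply AddCircle.injective_toCircle (one_ne_zero (α := ℝ))
    rw [AddCircle.toCircle_zero]
    ext
    rw [← fourier_one, Circle.coe_one]
    exact h
  rw [peak_apply, ← hw, norm_div, Complex.norm_ofNat, div_lt_one two_pos]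
  have hsq := Complex.sq_norm w
  rw [hw1, Complex.normSq_apply] at hsq
  have hre : w.re < 1 := by
    by_contra! h
    apply hne
    have him : w.im = 0 := by nlinarith
    have hre : w.re = 1 := by nlinarith
    exact Complex.ext hre him
  have : ‖1 + w‖ ^ 2 < 2 ^ 2 := by
    rw [Complex.sq_norm, Complex.normSq_apply]
    simp only [Complex.add_re, Complex.one_re, Complex.add_im, Complex.one_im, zero_add]
    nlinarith
  exact lt_of_pow_lt_pow_left₀ 2 two_pos.le this

theorem tendsto_peak_pow {x : 𝕋} (hx : x ≠ 0) :
    Filter.Tendsto (fun n : ℕ ↦ peak x ^ n) Filter.atTop (nhds 0) :=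
  tendsto_pow_atTop_nhds_zero_of_norm_lt_one (norm_peak_lt_one hx)

theorem exists_norm_peak_le_of_isCompact {K : Set 𝕋} (hK : IsCompact K) (h0 : 0 ∉ K) :
    ∃ θ : ℝ, 0 ≤ θ ∧ θ < 1 ∧ ∀ x ∈ K, ‖peak x‖ ≤ θ := by
  rcases K.eq_empty_or_nonempty with rfl | hne
  · exact ⟨0, le_rfl, one_pos, by simp⟩
  obtain ⟨z, hz, hmax⟩ := hK.exists_isMaxOn hne peak.continuous.norm.continuousOn
  exact ⟨‖peak z‖, norm_nonneg _, norm_peak_lt_one (ne_of_mem_of_not_mem hz h0), hmax⟩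

theorem exists_mem_add_self_ne_zero {E : Set 𝕋} (hE : 0 < volume E) :
    ∃ x ∈ E, x + x ≠ 0 := by
  have : NullSingletonClass (volume : Measure 𝕋) :=
    ⟨fun x ↦ by rw [← Metric.closedBall_zero, AddCircle.volume_closedBall]; simp⟩
  by_contra! h
  have hfin : {x : 𝕋 | 2 • x = 0}.Finite := AddCircle.finite_torsion 1 two_pos
  have : E ⊆ {x : 𝕋 | 2 • x = 0} := fun x hx ↦ by
    rw [Set.mem_ofPred_eq, two_nsmul]; exact h x hx
  exact hE.ne' ((hfin.subset this).measure_zero _)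

theorem exists_lt_forall_lt_integral_rpow {p B : ℝ} (hp : 2 < p) (h : C(𝕋, ℂ))
    (hB : B < ∫ y, ‖h y‖ ^ p) :
    ∃ q₀, 1 ≤ q₀ ∧ q₀ < p ∧ ∀ q, q₀ < q → q ≤ p → B < (∫ y, ‖h y‖ ^ q) ^ (p / q) := by
  have hc : Continuous fun q : ℝ ↦ ∫ y, ‖h y‖ ^ max q 1 := by
    refine continuous_integral_circle (f := fun q y ↦ ‖h y‖ ^ max q 1) ?_
    refine Continuous.rpow (by fun_prop) (by fun_prop) fun z ↦ Or.inr ?_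
    exact lt_of_lt_of_le one_pos (le_max_right _ _)
  have hc' : ContinuousAt (fun q : ℝ ↦ (∫ y, ‖h y‖ ^ max q 1) ^ (p / q)) p := by
    refine hc.continuousAt.rpow (continuousAt_const.div continuousAt_id (by simp; linarith))
      (Or.inr ?_)
    simpa only [id] using div_pos (by linarith) (by linarith)
  have hval : B < (∫ y, ‖h y‖ ^ max p 1) ^ (p / p) := by
    rwa [div_self (by linarith), Real.rpow_one, max_eq_left (by linarith)]
  obtain ⟨l, hl, hlp⟩ := exists_Ioc_subset_of_mem_nhds
    (Filter.Tendsto.eventually_const_lt hval hc') ⟨0, by linarith⟩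
  refine ⟨max l 1, le_max_right _ _, max_lt hl (by linarith), fun q hq hqp ↦ ?_⟩
  have := hlp ⟨(le_max_left _ _).trans_lt hq, hqp⟩
  have h1 : 1 < q := (le_max_right _ _).trans_lt hq
  simpa [max_eq_left h1.le] using this

theorem exists_concentrating_multipliers {p q α β : ℝ} (hp : 0 < p) (hq : 0 < q)
    {G₀ G₁ : C(𝕋, ℂ)} {E : Set 𝕋} (hEo : IsOpen E) (hEs : -E = E) (hE : 0 < volume E)
    (hβ : ∫ y, ‖G₀ y + G₁ y‖ ^ p < β) (hα : α < ∫ y, ‖(G₀ y - G₁ y) / 2‖ ^ q) :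
    ∃ C₀ ∈ posDefPoly, ∃ C₁ ∈ posDefPoly, ∃ χ ψ : C(𝕋, ℝ),
      (∀ x, 0 ≤ χ x) ∧ (∀ x ∈ Eᶜ, χ x = 1) ∧ (∀ x, 0 ≤ ψ x) ∧ (∀ x, ψ x ≤ 1) ∧
      0 < ∫ x, ψ x ∧
      (∀ x, χ x ≠ 0 → ∫ y, ‖C₀ x * G₀ y + C₁ x * G₁ y‖ ^ p ≤ β) ∧
      ∀ x, ψ x ≠ 0 → α ≤ ∫ y, ‖C₀ x * G₀ y + C₁ x * G₁ y‖ ^ q := by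
  obtain ⟨x₀, hx₀, hx₂⟩ := exists_mem_add_self_ne_zero hE
  have hx₁ : x₀ ≠ 0 := by rintro rfl; simp at hx₂
  have hx₀' : -x₀ ∈ E := by rw [← hEs]; simpa using hx₀
  obtain ⟨δ₁, hδ₁, hb₁⟩ := Metric.isOpen_iff.1 hEo x₀ hx₀
  obtain ⟨δ₂, hδ₂, hb₂⟩ := Metric.isOpen_iff.1 hEo (-x₀) hx₀'
  obtain ⟨δ, hδ, hδ'⟩ := exists_between (lt_min hδ₁ hδ₂)
  obtain ⟨hd₁, hd₂⟩ := lt_min_iff.1 hδ'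
  obtain ⟨χ, hχ0, hχ1, hχ⟩ := exists_continuous_zero_one_of_isClosed
    (s := Metric.closedBall x₀ δ ∪ Metric.closedBall (-x₀) δ) (t := Eᶜ)
    (Metric.isClosed_closedBall.union Metric.isClosed_closedBall) hEo.isClosed_compl (by
      rw [Set.disjoint_compl_right_iff_subset]
      exact Set.union_subset ((Metric.closedBall_subset_ball hd₁).trans hb₁)
        ((Metric.closedBall_subset_ball hd₂).trans hb₂))
  obtain ⟨θ, hθ0, hθ1, hθ⟩ := exists_norm_peak_le_of_isCompact
    (K := {z : 𝕋 | δ ≤ ‖z‖}) (isClosed_le continuous_const continuous_norm).isCompact (by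
      simpa using hδ)
  -- the mean on the complement of the window
  have hΛ : Continuous fun t : ℝ ↦ ∫ y, (‖G₀ y + G₁ y‖ + t * ‖G₀ y - G₁ y‖) ^ p := by
    refine continuous_integral_circle
      (f := fun t y ↦ (‖G₀ y + G₁ y‖ + t * ‖G₀ y - G₁ y‖) ^ p) ?_
    exact Continuous.rpow_const (by fun_prop) fun _ ↦ Or.inr hp.le
  have hΛlim : ∀ᶠ n : ℕ in Filter.atTop,
      ∫ y, (‖G₀ y + G₁ y‖ + θ ^ n * ‖G₀ y - G₁ y‖) ^ p < β := by
    have hval : ∫ y, (‖G₀ y + G₁ y‖ + 0 * ‖G₀ y - G₁ y‖) ^ p < β := by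
      simpa only [zero_mul, add_zero] using hβ
    exact (tendsto_pow_atTop_nhds_zero_of_lt_one hθ0 hθ1).eventually
      (hΛ.continuousAt.eventually_lt_const hval)
  -- the mean near the centre of the window
  have hΘ : Continuous fun z : ℂ × ℂ ↦ ∫ y, ‖z.1 * G₀ y + z.2 * G₁ y‖ ^ q := by
    refine continuous_integral_circle (f := fun (z : ℂ × ℂ) y ↦ ‖z.1 * G₀ y + z.2 * G₁ y‖ ^ q) ?_
    exact continuous_norm_rpow (by fun_prop) hq.le
  have hτ : Filter.Tendsto (fun n : ℕ ↦ translateAvg x₀ (peak ^ n) x₀) Filter.atTop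
      (nhds (1 / 2)) := by
    have := ((tendsto_peak_pow hx₂).const_add 1).div_const 2
    simpa [translateAvg_apply, peak_zero] using this
  have hκ : Filter.Tendsto (fun n : ℕ ↦ (peak ^ n) x₀) Filter.atTop (nhds 0) := by
    simpa using tendsto_peak_pow hx₁
  have hΘlim : ∀ᶠ n : ℕ in Filter.atTop,
      α < ∫ y, ‖((peak ^ n) x₀ + translateAvg x₀ (peak ^ n) x₀) * G₀ y +
        ((peak ^ n) x₀ - translateAvg x₀ (peak ^ n) x₀) * G₁ y‖ ^ q := by
    have hval : α < ∫ y, ‖((0 : ℂ) + 1 / 2) * G₀ y + ((0 : ℂ) - 1 / 2) * G₁ y‖ ^ q := by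
      convert hα using 5
      ring
    have hlim := (hκ.add hτ).prodMk_nhds (hκ.sub hτ)
    exact hlim.eventually (hΘ.continuousAt.eventually_const_lt hval)
  obtain ⟨n, hn₁, hn₂⟩ := (hΛlim.and hΘlim).exists
  obtain ⟨hC₀, hC₁⟩ := add_sub_translateAvg_mem_posDefPoly
    (Subalgebra.pow_mem _ peak_mem_posDefPoly n) x₀
  set κ : C(𝕋, ℂ) := peak ^ n with hκdef
  set τ : C(𝕋, ℂ) := translateAvg x₀ κ with hτdef
  have hM : Continuous fun x ↦ ∫ y, ‖(κ + τ) x * G₀ y + (κ - τ) x * G₁ y‖ ^ q := by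
    refine continuous_integral_circle
      (f := fun x y ↦ ‖(κ + τ) x * G₀ y + (κ - τ) x * G₁ y‖ ^ q) ?_
    exact continuous_norm_rpow (by fun_prop) hq.le
  obtain ⟨ψ, hψ0, hψ1, hψ⟩ := exists_continuous_zero_one_of_isClosed
    (s := {x | ∫ y, ‖(κ + τ) x * G₀ y + (κ - τ) x * G₁ y‖ ^ q ≤ α}) (t := {x₀})
    (isClosed_le hM continuous_const) isClosed_singleton (by
      rw [Set.disjoint_singleton_right]; exact not_le.2 hn₂)
  refine ⟨κ + τ, hC₀, κ - τ, hC₁, χ, ψ, fun x ↦ (hχ x).1, fun x hx ↦ hχ1 hx, fun x ↦ (hψ x).1,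
    fun x ↦ (hψ x).2, ?_, fun x hx ↦ ?_, fun x hx ↦ ?_⟩
  · refine ψ.continuous.integral_pos_of_hasCompactSupport_nonneg_nonzero
      (HasCompactSupport.of_compactSpace _) (fun x ↦ (hψ x).1) (x := x₀) ?_
    rw [hψ1 rfl]; exact one_ne_zero
  · have hx' : x ∉ Metric.closedBall x₀ δ ∪ Metric.closedBall (-x₀) δ := fun h ↦ hx (hχ0 h)
    rw [Set.mem_union, not_or, Metric.mem_closedBall, Metric.mem_closedBall, not_le, not_le,
      dist_eq_norm, dist_eq_norm, sub_neg_eq_add] at hx'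
    have hpow (z : 𝕋) (hz : δ < ‖z‖) : ‖κ z‖ ≤ θ ^ n := by
      rw [hκdef, ContinuousMap.pow_apply, norm_pow]
      exact pow_le_pow_left₀ (norm_nonneg _) (hθ z hz.le) n
    have hτx : ‖τ x‖ ≤ θ ^ n := by
      rw [hτdef, translateAvg_apply, norm_div, Complex.norm_ofNat, div_le_iff₀ two_pos]
      linarith [norm_add_le (κ (x - x₀)) (κ (x + x₀)), hpow _ hx'.1, hpow _ hx'.2]
    have hκx : ‖κ x‖ ≤ 1 := by
      rw [hκdef, ContinuousMap.pow_apply, norm_pow]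
      exact pow_le_one₀ (norm_nonneg _) (norm_peak_le_one x)
    refine le_trans ?_ hn₁.le
    have hi₁ : Integrable fun y ↦ ‖(κ + τ) x * G₀ y + (κ - τ) x * G₁ y‖ ^ p :=
      integrable_of_continuous_circle (continuous_norm_rpow (by fun_prop) hp.le)
    have hi₂ : Integrable fun y ↦ (‖G₀ y + G₁ y‖ + θ ^ n * ‖G₀ y - G₁ y‖) ^ p :=
      integrable_of_continuous_circle
        (Continuous.rpow_const (by fun_prop) fun _ ↦ Or.inr hp.le)
    refine integral_mono hi₁ hi₂ fun y ↦ Real.rpow_le_rpow (norm_nonneg _) ?_ hp.le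
    calc ‖(κ + τ) x * G₀ y + (κ - τ) x * G₁ y‖
        = ‖κ x * (G₀ y + G₁ y) + τ x * (G₀ y - G₁ y)‖ := by
          rw [ContinuousMap.add_apply, ContinuousMap.sub_apply]; congr 1; ring
      _ ≤ ‖κ x‖ * ‖G₀ y + G₁ y‖ + ‖τ x‖ * ‖G₀ y - G₁ y‖ := by
          rw [← norm_mul, ← norm_mul]; exact norm_add_le _ _
      _ ≤ 1 * ‖G₀ y + G₁ y‖ + θ ^ n * ‖G₀ y - G₁ y‖ := by gcongr
      _ = _ := by rw [one_mul]
  · by_contra! h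
    exact hx (hψ0 h.le)

theorem exists_mul_pow_le_mul_pow {a b β γ : ℝ} (hb : 0 < b) (hβ : 0 < β)
    (hβγ : β < γ) : ∃ N : ℕ, a * β ^ N ≤ b * γ ^ N := by
  have hγ := hβ.trans hβγ
  have hlim : Filter.Tendsto (fun N : ℕ ↦ a * (β / γ) ^ N) Filter.atTop (nhds 0) := by
    simpa using (tendsto_pow_atTop_nhds_zero_of_lt_one (div_pos hβ hγ).le
      ((div_lt_one hγ).2 hβγ)).const_mul a
  obtain ⟨N, hN⟩ := (hlim.eventually_lt_const hb).exists
  refine ⟨N, ?_⟩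
  rw [div_pow, mul_div_assoc', div_lt_iff₀ (pow_pos hγ N)] at hN
  exact hN.le

theorem exists_concentrated_posDefPoly {p q ε : ℝ} (hp : 0 < p) (hq : 0 < q)
    {G₀ G₁ : C(𝕋, ℂ)} (hG₀ : G₀ ∈ posDefPoly) (hG₁ : G₁ ∈ posDefPoly)
    (hG : ∫ y, ‖G₀ y + G₁ y‖ ^ p < (∫ y, ‖(G₀ y - G₁ y) / 2‖ ^ q) ^ (p / q))
    {E : Set 𝕋} (hEo : IsOpen E) (hEs : -E = E) (hE : 0 < volume E) (hε : 0 < ε) :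
    ∃ f ∈ posDefPoly, 0 < ∫ x, ‖f x‖ ^ q ∧
      ∫ x in Eᶜ, ‖f x‖ ^ p ≤ ε * (∫ x, ‖f x‖ ^ q) ^ (p / q) := by
  obtain ⟨β, hGβ, hβ⟩ := exists_between hG
  obtain ⟨γ, hβγ, hγ⟩ := exists_between hβ
  have hβ0 : 0 < β := (integral_nonneg fun y ↦ by positivity).trans_lt hGβ
  have hγ0 : 0 < γ := hβ0.trans hβγ
  have hr : 0 < p / q := div_pos hp hq
  have hαγ : (γ ^ (q / p)) ^ (p / q) = γ := by
    rw [← Real.rpow_mul hγ0.le, div_mul_div_cancel₀ hp.ne', div_self hq.ne', Real.rpow_one]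
  have hα : γ ^ (q / p) < ∫ y, ‖(G₀ y - G₁ y) / 2‖ ^ q := by
    refine lt_of_not_ge fun h ↦ hγ.not_ge ?_
    rw [← hαγ]
    exact Real.rpow_le_rpow (integral_nonneg fun y ↦ by positivity) h hr.le
  have hα0 : 0 < γ ^ (q / p) := Real.rpow_pos_of_pos hγ0 _
  obtain ⟨C₀, hC₀, C₁, hC₁, χ, ψ, hχ0, hχ1, hψ0, hψ1, hψ, hupper, hlower⟩ :=
    exists_concentrating_multipliers hp hq hEo hEs hE hGβ hα
  have hψ2 : 0 < (∫ x, ψ x) / 2 := half_pos hψ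
  obtain ⟨N, hN⟩ := exists_mul_pow_le_mul_pow (a := (∫ x, χ x) + 1)
    (mul_pos hε (Real.rpow_pos_of_pos hψ2 (p / q))) hβ0 hβγ
  obtain ⟨f, hf, h1, h2⟩ := exists_product_estimates hp.le hq.le hα0 hβ0 hC₀ hC₁ hG₀ hG₁
    hχ0 hψ0 hψ hupper hlower N
  have hip := continuous_norm_rpow f.continuous hp.le
  have hiq := continuous_norm_rpow f.continuous hq.le
  have hlow : (∫ x, ψ x) / 2 * (γ ^ (q / p)) ^ N < ∫ x, ‖f x‖ ^ q := by
    refine h2.trans_le (integral_mono (integrable_of_continuous_circle (ψ.continuous.mul hiq))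
      (integrable_of_continuous_circle hiq) fun x ↦ ?_)
    exact mul_le_of_le_one_left (by positivity) (hψ1 x)
  refine ⟨f, hf, (mul_pos hψ2 (pow_pos hα0 N)).trans hlow, ?_⟩
  calc ∫ x in Eᶜ, ‖f x‖ ^ p = ∫ x in Eᶜ, χ x * ‖f x‖ ^ p :=
        setIntegral_congr_fun hEo.measurableSet.compl fun x hx ↦ by
          simp only [hχ1 x hx, one_mul]
    _ ≤ ∫ x, χ x * ‖f x‖ ^ p :=
        setIntegral_le_integral (integrable_of_continuous_circle (χ.continuous.mul hip))
          (.of_forall fun x ↦ mul_nonneg (hχ0 x) (by positivity))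
    _ ≤ ((∫ x, χ x) + 1) * β ^ N := h1.le
    _ ≤ ε * ((∫ x, ψ x) / 2) ^ (p / q) * γ ^ N := hN
    _ = ε * ((∫ x, ψ x) / 2 * (γ ^ (q / p)) ^ N) ^ (p / q) := by
        rw [Real.mul_rpow hψ2.le (pow_nonneg hα0.le N), ← Real.rpow_pow_comm hα0.le, hαγ, mul_assoc]
    _ ≤ ε * (∫ x, ‖f x‖ ^ q) ^ (p / q) :=
        mul_le_mul_of_nonneg_left (Real.rpow_le_rpow (mul_pos hψ2 (pow_pos hα0 N)).le hlow.le
          hr.le) hε.le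

/-- **Strong concentration for `p > 2` not an even integer.** There is `q(p) < p`
such that for every `q` with `q(p) < q ≤ p`, every `0`-symmetric open set
`E ⊆ 𝕋` of positive measure and every `ε > 0`, some nonzero positive definite
trigonometric polynomial `f` satisfies `∫_{𝕋∖E} |f|^p ≤ ε (∫_𝕋 |f|^q)^{p/q}`. -/
theorem strong_concentration_gt_two
    (p : ℝ) (hp : 2 < p) (hpe : ∀ m : ℕ, p ≠ 2 * m) :
    ∃ q₀ : ℝ, q₀ < p ∧
      ∀ q : ℝ, q₀ < q → q ≤ p →
        ∀ E : Set (AddCircle (1 : ℝ)), IsOpen E → (-E) = E → 0 < volume E →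
          ∀ ε : ℝ, 0 < ε →
            ∃ (H : Finset ℤ) (c : ℤ → ℝ), H.Nonempty ∧ (∀ k ∈ H, 0 < c k) ∧
              (∫ x in Eᶜ, ‖∑ k ∈ H, (c k : ℂ) * fourier k x‖ ^ p ∂volume) ≤
                ε * (∫ x : AddCircle (1 : ℝ), ‖∑ k ∈ H, (c k : ℂ) * fourier k x‖ ^ q) ^ (p / q) := by
  obtain ⟨G₀, hG₀, G₁, hG₁, hG⟩ := exists_large_majorant_failure hp hpe (2 ^ p)
  have hlarge : ∫ y, ‖G₀ y + G₁ y‖ ^ p < ∫ y, ‖(((1 / 2 : ℂ) • (G₀ - G₁) : C(𝕋, ℂ)) y)‖ ^ p := by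
    have h2 : ∀ y, ‖(((1 / 2 : ℂ) • (G₀ - G₁) : C(𝕋, ℂ)) y)‖ ^ p =
        (2 ^ p)⁻¹ * ‖G₀ y - G₁ y‖ ^ p := fun y ↦ by
      rw [ContinuousMap.smul_apply, ContinuousMap.sub_apply, norm_smul,
        Real.mul_rpow (norm_nonneg _) (norm_nonneg _), norm_div, norm_one, Complex.norm_ofNat,
        one_div, Real.inv_rpow two_pos.le]
    simp_rw [h2]
    rwa [integral_const_mul, lt_inv_mul_iff₀ (by positivity)]
  obtain ⟨q₀, hq₀1, hq₀p, hq₀⟩ := exists_lt_forall_lt_integral_rpow hp _ hlarge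
  refine ⟨q₀, hq₀p, fun q hq hqp E hEo hEs hE ε hε ↦ ?_⟩
  have hq0 : 0 < q := by linarith
  have hmaj : ∫ y, ‖G₀ y + G₁ y‖ ^ p < (∫ y, ‖(G₀ y - G₁ y) / 2‖ ^ q) ^ (p / q) := by
    simpa only [ContinuousMap.smul_apply, ContinuousMap.sub_apply, smul_eq_mul,
      one_div_mul_eq_div] using hq₀ q hq hqp
  obtain ⟨f, hf, hpos, hle⟩ :=
    exists_concentrated_posDefPoly (by linarith) hq0 hG₀ hG₁ hmaj hEo hEs hE hε
  obtain ⟨H, c, hc, hfc⟩ := exists_coeff_of_mem_posDefPoly hf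
  refine ⟨H, c, ?_, hc, by simpa only [hfc] using hle⟩
  rw [Finset.nonempty_iff_ne_empty]
  rintro rfl
  simp [hfc, Real.zero_rpow hq0.ne'] at hpos
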